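/- Let U : L²(𝕋²) → L²(𝕋²) be a unitary operator that maps C^∞ functions to C^∞ functions and commutes with ∂/∂x₁ and ∂/∂x₂ on C^∞ functions. Let 0 < δ < 1 and let ν be a C^∞ function on 𝕋² with |ν| ≤ δ everywhere. Then for every C^∞ function f on 𝕋² there exists a unique u ∈ L²(𝕋²) with u − U(ν·u) = f; this u is C^∞, and with C = 4/(1−δ)² it satisfies (‖u‖²_{L²} + ‖∂u/∂x₁‖²_{L²} + ‖∂u/∂x₂‖²_{L²})^{1/2} ≤ C·(1 + max|∂ν/∂x₁| + max|∂ν/∂x₂|)·(‖f‖²_{L²} + ‖∂f/∂x₁‖²_{L²} + ‖∂f/∂x₂‖²_{L²})^{1/2}. -/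

import Mathlib

open MeasureTheory

instance : Fact ((0:ℝ) < 2 * Real.pi) := ⟨by positivity⟩

/-- The two-torus `𝕋² = ℝ²/2πℤ²`. -/
abbrev T2 : Type := AddCircle (2 * Real.pi) × AddCircle (2 * Real.pi)

/-- The canonical projection `ℝ² → 𝕋²`. -/
noncomputable def projT2 : ℝ × ℝ → T2 := fun p => (↑p.1, ↑p.2)

lemma projT2_surjective : Function.Surjective projT2 := by
  rintro ⟨x, y⟩
  obtain ⟨a, ha⟩ := QuotientAddGroup.mk_surjective x
  obtain ⟨b, hb⟩ := QuotientAddGroup.mk_surjective y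
  exact ⟨(a, b), by simp [projT2, ha, hb]⟩

/-- A choice of lift `𝕋² → ℝ²` (a set-theoretic section of `projT2`). -/
noncomputable def liftT2 : T2 → ℝ × ℝ := Function.surjInv projT2_surjective

/-- A function on the torus is `C^∞` iff its (doubly periodic) lift to `ℝ²` is `C^∞`. -/
def SmoothT2 (F : T2 → ℂ) : Prop := ContDiff ℝ (⊤ : ℕ∞) (F ∘ projT2)

/-- The partial derivative `∂F/∂x₁` of a function on the torus. -/
noncomputable def pd1 (F : T2 → ℂ) : T2 → ℂ := fun q =>
  fderiv ℝ (F ∘ projT2) (liftT2 q) (1, 0)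

/-- The partial derivative `∂F/∂x₂` of a function on the torus. -/
noncomputable def pd2 (F : T2 → ℂ) : T2 → ℂ := fun q =>
  fderiv ℝ (F ∘ projT2) (liftT2 q) (0, 1)

/-- `∂_z = (1/2)(∂/∂x₁ − i ∂/∂x₂)` on the torus (`z = x₁ + i x₂`). -/
noncomputable def dzT2 (F : T2 → ℂ) : T2 → ℂ := fun q =>
  (pd1 F q - Complex.I * pd2 F q) / 2

/-- `∂_z̄ = (1/2)(∂/∂x₁ + i ∂/∂x₂)` on the torus (`z = x₁ + i x₂`). -/
noncomputable def dzbarT2 (F : T2 → ℂ) : T2 → ℂ := fun q =>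
  (pd1 F q + Complex.I * pd2 F q) / 2

/-- The character `e_n(x) = e^{i(n₁x₁+n₂x₂)}` on the torus, `n ∈ ℤ²`. -/
noncomputable def eT2 (n : ℤ × ℤ) : T2 → ℂ := fun q =>
  Complex.exp (Complex.I * ((n.1 : ℂ) * ((liftT2 q).1 : ℂ) + (n.2 : ℂ) * ((liftT2 q).2 : ℂ)))

/-- The complex `L²` space of the torus. -/
abbrev L2T2 : Type := Lp ℂ 2 (volume : Measure T2)

/-- The squared `L²` norm `∫ |g|²` of a function on the torus. -/
noncomputable def l2sq (g : T2 → ℂ) : ℝ := ∫ q : T2, ‖g q‖ ^ 2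

/-- The first Sobolev norm `(‖g‖² + ‖∂g/∂x₁‖² + ‖∂g/∂x₂‖²)^{1/2}`. -/
noncomputable def sob1 (g : T2 → ℂ) : ℝ :=
  Real.sqrt (l2sq g + l2sq (pd1 g) + l2sq (pd2 g))

/-- A unitary operator `U` on `L²(𝕋²)` "maps `C^∞` functions to `C^∞` functions and
commutes with `∂/∂x₁` and `∂/∂x₂` on them": for every smooth `φ` there is a smooth
`ψ` (representing `U φ`) such that `U` sends (the class of) `φ` to `ψ` and (the
class of) `∂φ/∂x_r` to `∂ψ/∂x_r` for `r = 1, 2`. -/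
def SmoothCompat (U : L2T2 ≃ₗᵢ[ℂ] L2T2) : Prop :=
  ∀ φ : T2 → ℂ, SmoothT2 φ → ∃ ψ : T2 → ℂ, SmoothT2 ψ ∧
    (∀ g : L2T2, ⇑g =ᵐ[volume] φ → ⇑(U g) =ᵐ[volume] ψ) ∧
    (∀ g : L2T2, ⇑g =ᵐ[volume] pd1 φ → ⇑(U g) =ᵐ[volume] pd1 ψ) ∧
    (∀ g : L2T2, ⇑g =ᵐ[volume] pd2 φ → ⇑(U g) =ᵐ[volume] pd2 ψ)

lemma isOpenQuotientMap_projT2 : IsOpenQuotientMap projT2 := by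
  have h : IsOpenQuotientMap (fun x : ℝ => (x : AddCircle (2 * Real.pi))) :=
    QuotientAddGroup.isOpenQuotientMap_mk
  exact h.prodMap h

lemma projT2_lift (q : T2) : projT2 (liftT2 q) = q := Function.surjInv_eq _ q

lemma SmoothT2.cont {g : T2 → ℂ} (hg : SmoothT2 g) : Continuous g :=
  isOpenQuotientMap_projT2.isQuotientMap.continuous_iff.2 (ContDiff.continuous hg)

lemma fderiv_lift (g : T2 → ℂ) (p : ℝ × ℝ) :
    fderiv ℝ (g ∘ projT2) (liftT2 (projT2 p)) = fderiv ℝ (g ∘ projT2) p := by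
  set c := liftT2 (projT2 p) - p with hc
  have h1 : projT2 (p + c) = projT2 p := by
    rw [hc, add_sub_cancel, projT2_lift]
  have h2 : ∀ x, projT2 (x + c) = projT2 x := by
    intro x
    simp only [projT2, Prod.ext_iff, Prod.fst_add, Prod.snd_add, AddCircle.coe_add] at h1 ⊢
    simpa using h1
  have h3 : (fun x => (g ∘ projT2) (x + c)) = g ∘ projT2 := by
    funext x; simp [h2]
  have h4 : liftT2 (projT2 p) = p + c := by rw [hc, add_sub_cancel]
  rw [h4, ← fderiv_comp_add_right, h3]

/-- Both partial derivatives, indexed by a boolean. -/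
noncomputable def pdb (b : Bool) (F : T2 → ℂ) : T2 → ℂ := if b then pd1 F else pd2 F

def eb (b : Bool) : ℝ × ℝ := if b then (1, 0) else (0, 1)

lemma pdb_proj (b : Bool) (g : T2 → ℂ) (p : ℝ × ℝ) :
    pdb b g (projT2 p) = fderiv ℝ (g ∘ projT2) p (eb b) := by
  cases b <;> simp [pdb, pd1, pd2, eb, fderiv_lift]

lemma SmoothT2.pdb {g : T2 → ℂ} (hg : SmoothT2 g) (b : Bool) : SmoothT2 (pdb b g) := by
  unfold SmoothT2
  have : _root_.pdb b g ∘ projT2 = fun p => fderiv ℝ (g ∘ projT2) p (eb b) := by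
    funext p; exact pdb_proj b g p
  rw [this]
  have h : ContDiff ℝ (⊤ : ℕ∞) (fderiv ℝ (g ∘ projT2)) :=
    ContDiff.fderiv_right (n := (⊤ : ℕ∞)) hg (by simp)
  exact h.clm_apply contDiff_const

lemma SmoothT2.add {g h : T2 → ℂ} (hg : SmoothT2 g) (hh : SmoothT2 h) :
    SmoothT2 (fun q => g q + h q) := ContDiff.add hg hh
lemma SmoothT2.sub {g h : T2 → ℂ} (hg : SmoothT2 g) (hh : SmoothT2 h) :
    SmoothT2 (fun q => g q - h q) := ContDiff.sub hg hh
lemma SmoothT2.mul {g h : T2 → ℂ} (hg : SmoothT2 g) (hh : SmoothT2 h) :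
    SmoothT2 (fun q => g q * h q) := ContDiff.mul hg hh

lemma SmoothT2.diff {g : T2 → ℂ} (hg : SmoothT2 g) : Differentiable ℝ (g ∘ projT2) :=
  ContDiff.differentiable hg (by simp)

lemma pdb_add (b : Bool) {g h : T2 → ℂ} (hg : SmoothT2 g) (hh : SmoothT2 h) :
    pdb b (fun q => g q + h q) = fun q => pdb b g q + pdb b h q := by
  funext q
  obtain ⟨p, rfl⟩ := projT2_surjective q
  simp only [pdb_proj]
  have : (fun q => g q + h q) ∘ projT2 = (g ∘ projT2) + (h ∘ projT2) := rfl
  rw [this, fderiv_add (hg.diff p) (hh.diff p)]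
  simp

lemma pdb_sub (b : Bool) {g h : T2 → ℂ} (hg : SmoothT2 g) (hh : SmoothT2 h) :
    pdb b (fun q => g q - h q) = fun q => pdb b g q - pdb b h q := by
  funext q
  obtain ⟨p, rfl⟩ := projT2_surjective q
  simp only [pdb_proj]
  have : (fun q => g q - h q) ∘ projT2 = (g ∘ projT2) - (h ∘ projT2) := rfl
  rw [this, fderiv_sub (hg.diff p) (hh.diff p)]
  simp

lemma pdb_mul (b : Bool) {g h : T2 → ℂ} (hg : SmoothT2 g) (hh : SmoothT2 h) :
    pdb b (fun q => g q * h q) = fun q => pdb b g q * h q + g q * pdb b h q := by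
  funext q
  obtain ⟨p, rfl⟩ := projT2_surjective q
  simp only [pdb_proj]
  have : (fun q => g q * h q) ∘ projT2 = (g ∘ projT2) * (h ∘ projT2) := rfl
  rw [this, fderiv_mul (hg.diff p) (hh.diff p)]
  simp
  ring

/-- Iterated derivatives along a word. -/
noncomputable def Dw : List Bool → (T2 → ℂ) → T2 → ℂ
  | [], g => g
  | b :: l, g => Dw l (pdb b g)

lemma SmoothT2.Dw (l : List Bool) : ∀ {g : T2 → ℂ}, SmoothT2 g → SmoothT2 (Dw l g) := by
  induction l with
  | nil => intro g hg; exact hg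
  | cons b l ih => intro g hg; exact ih (hg.pdb b)

lemma Dw_add (l : List Bool) : ∀ {g h : T2 → ℂ}, SmoothT2 g → SmoothT2 h →
    Dw l (fun q => g q + h q) = fun q => Dw l g q + Dw l h q := by
  induction l with
  | nil => intro g h hg hh; rfl
  | cons b l ih =>
    intro g h hg hh
    simp only [Dw]
    rw [pdb_add b hg hh, ih (hg.pdb b) (hh.pdb b)]

/-- The `L²` norm of a function. -/
noncomputable def nrm (g : T2 → ℂ) : ℝ := (eLpNorm g 2 (volume : Measure T2)).toReal

lemma memLp_of_cont {g : T2 → ℂ} (hg : Continuous g) (p : ENNReal) :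
    MemLp g p (volume : Measure T2) := by
  exact hg.memLp_of_hasCompactSupport (HasCompactSupport.of_compactSpace g)

lemma nrm_nonneg (g : T2 → ℂ) : 0 ≤ nrm g := ENNReal.toReal_nonneg

lemma nrm_add_le {g h : T2 → ℂ} (hg : Continuous g) (hh : Continuous h) :
    nrm (fun q => g q + h q) ≤ nrm g + nrm h := by
  have h1 := memLp_of_cont hg 2
  have h2 := memLp_of_cont hh 2
  unfold nrm
  rw [← ENNReal.toReal_add h1.2.ne h2.2.ne]
  exact ENNReal.toReal_mono (ENNReal.add_ne_top.2 ⟨h1.2.ne, h2.2.ne⟩)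
    (eLpNorm_add_le h1.1 h2.1 (by norm_num))

lemma nrm_mul_le {g h : T2 → ℂ} (hh : Continuous h) {C : ℝ}
    (hC : ∀ q, ‖g q‖ ≤ C) : nrm (fun q => g q * h q) ≤ C * nrm h := by
  have hC0 : 0 ≤ C := (norm_nonneg _).trans (hC 0)
  have h2 := memLp_of_cont hh 2
  have := eLpNorm_le_mul_eLpNorm_of_ae_le_mul (μ := (volume : Measure T2))
    (f := fun q => g q * h q) (g := h) (c := C) (Filter.Eventually.of_forall (fun q => by
      rw [norm_mul]; exact mul_le_mul_of_nonneg_right (hC q) (norm_nonneg _))) 2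
  have h3 := ENNReal.toReal_mono (ENNReal.mul_ne_top ENNReal.ofReal_ne_top h2.2.ne) this
  rwa [ENNReal.toReal_mul, ENNReal.toReal_ofReal hC0] at h3

lemma l2sq_eq {g : T2 → ℂ} (hg : Continuous g) : l2sq g = nrm g ^ 2 := by
  have h2 := memLp_of_cont hg 2
  unfold nrm l2sq
  have h := h2.eLpNorm_eq_integral_rpow_norm (by norm_num) (by norm_num)
  rw [h, ENNReal.toReal_ofReal (by positivity)]
  simp only [ENNReal.toReal_ofNat, Real.rpow_ofNat]
  rw [← Real.rpow_natCast, ← Real.rpow_mul (by positivity)]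
  norm_num

lemma nrm_of_ae {g : L2T2} {h : T2 → ℂ} (e : ⇑g =ᵐ[volume] h) : ‖g‖ = nrm h := by
  rw [Lp.norm_def, eLpNorm_congr_ae e]; rfl

lemma bdd_of_cont {g : T2 → ℂ} (hg : Continuous g) : BddAbove (Set.range fun q => ‖g q‖) :=
  (isCompact_range hg.norm).bddAbove

lemma exists_bound {g : T2 → ℂ} (hg : Continuous g) : ∃ C, ∀ q, ‖g q‖ ≤ C := by
  obtain ⟨C, hC⟩ := bdd_of_cont hg
  exact ⟨C, fun q => hC ⟨q, rfl⟩⟩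

/-- `ψ` is the smooth image of the smooth function `φ` under `U`. -/
def URel (U : L2T2 ≃ₗᵢ[ℂ] L2T2) (φ ψ : T2 → ℂ) : Prop :=
  SmoothT2 φ ∧ SmoothT2 ψ ∧ ∀ g : L2T2, ⇑g =ᵐ[volume] φ → ⇑(U g) =ᵐ[volume] ψ

lemma exists_class {g : T2 → ℂ} (hg : Continuous g) : ∃ G : L2T2, ⇑G =ᵐ[volume] g :=
  ⟨(memLp_of_cont hg 2).toLp g, MemLp.coeFn_toLp _⟩

lemma URel.pdb {U : L2T2 ≃ₗᵢ[ℂ] L2T2} (hU : SmoothCompat U) {φ ψ : T2 → ℂ} (h : URel U φ ψ)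
    (b : Bool) : URel U (pdb b φ) (pdb b ψ) := by
  obtain ⟨ψ', h1, h2, h3, h4⟩ := hU φ h.1
  have : ψ = ψ' := by
    obtain ⟨G, hG⟩ := exists_class h.1.cont
    exact (Continuous.ae_eq_iff_eq volume h.2.1.cont h1.cont).1
      ((h.2.2 G hG).symm.trans (h2 G hG))
  subst this
  refine ⟨h.1.pdb b, h.2.1.pdb b, ?_⟩
  cases b
  · simpa [_root_.pdb] using h4
  · simpa [_root_.pdb] using h3

lemma URel.Dw {U : L2T2 ≃ₗᵢ[ℂ] L2T2} (hU : SmoothCompat U) (l : List Bool) :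
    ∀ {φ ψ : T2 → ℂ}, URel U φ ψ → URel U (Dw l φ) (Dw l ψ) := by
  induction l with
  | nil => intro φ ψ h; exact h
  | cons b l ih => intro φ ψ h; exact ih (h.pdb hU b)

lemma URel.nrm {U : L2T2 ≃ₗᵢ[ℂ] L2T2} {φ ψ : T2 → ℂ} (h : URel U φ ψ) : nrm ψ = nrm φ := by
  obtain ⟨G, hG⟩ := exists_class h.1.cont
  rw [← nrm_of_ae hG, ← nrm_of_ae (h.2.2 G hG), U.norm_map]

lemma summable_of_contract {a b : ℕ → ℝ} (ha : ∀ n, 0 ≤ a n) {δ : ℝ} (hδ0 : 0 < δ) (hδ1 : δ < 1)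
    (hb0 : ∀ n, 0 ≤ b n)
    (hb : Summable b) (h : ∀ n, a (n + 1) ≤ δ * a n + b n) : Summable a := by
  refine summable_of_sum_range_le (c := (a 0 + ∑' n, b n) / (1 - δ)) ha ?_
  intro n
  have h1 : ∑ i ∈ Finset.range n, a i ≤ ∑ i ∈ Finset.range (n + 1), a i :=
    Finset.sum_le_sum_of_subset_of_nonneg (Finset.range_mono (Nat.le_succ n))
      (fun i _ _ => ha i)
  have h2 : ∑ i ∈ Finset.range (n + 1), a i ≤
      δ * ∑ i ∈ Finset.range n, a i + ∑ i ∈ Finset.range n, b i + a 0 := by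
    rw [Finset.sum_range_succ', Finset.mul_sum, ← Finset.sum_add_distrib]
    gcongr with i _
    exact h i
  have h3 := hb.sum_le_tsum (Finset.range n) (fun i _ => hb0 i)
  rw [le_div_iff₀ (by linarith)]
  nlinarith

/-- Commutator summability. -/
lemma comm_summable (l : List Bool) : ∀ (μ : T2 → ℂ) (w : ℕ → T2 → ℂ), SmoothT2 μ →
    (∀ n, SmoothT2 (w n)) →
    (∀ l' : List Bool, l'.length < l.length → Summable fun n => nrm (Dw l' (w n))) →
    ∃ b : ℕ → ℝ, (∀ n, 0 ≤ b n) ∧ Summable b ∧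
      ∀ n, nrm (fun q => Dw l (fun q => μ q * w n q) q - μ q * Dw l (w n) q) ≤ b n := by
  induction l with
  | nil =>
    intro μ w _ _ _
    refine ⟨fun _ => 0, by simp, summable_zero, fun n => ?_⟩
    simp [Dw, nrm]
  | cons c l ih =>
    intro μ w hμ hw hs
    obtain ⟨b1, h1, h1s, h1b⟩ := ih (pdb c μ) w (hμ.pdb c) hw
      (fun l' hl' => hs l' (by simp; omega))
    obtain ⟨b2, h2, h2s, h2b⟩ := ih μ (fun n => pdb c (w n)) hμ (fun n => (hw n).pdb c)
      (fun l' hl' => hs (c :: l') (by simpa using hl'))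
    obtain ⟨C, hC⟩ := exists_bound (hμ.pdb c).cont
    have hC0 : 0 ≤ C := (norm_nonneg _).trans (hC 0)
    refine ⟨fun n => b1 n + C * nrm (Dw l (w n)) + b2 n, fun n => ?_, ?_, fun n => ?_⟩
    · have := h1 n
      have := h2 n
      have := nrm_nonneg (Dw l (w n))
      positivity
    · exact (h1s.add ((hs l (by simp)).mul_left C)).add h2s
    · simp only [Dw]
      have e1 := (hμ.pdb c).mul (hw n)
      have e2 := hμ.mul ((hw n).pdb c)
      rw [pdb_mul c hμ (hw n), Dw_add l e1 e2]
      have e : (fun q => Dw l (fun q => pdb c μ q * w n q) q + Dw l (fun q => μ q * pdb c (w n) q) q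
            - μ q * Dw l (pdb c (w n)) q) =
          fun q => ((Dw l (fun q => pdb c μ q * w n q) q - pdb c μ q * Dw l (w n) q)
            + pdb c μ q * Dw l (w n) q) +
            (Dw l (fun q => μ q * pdb c (w n) q) q - μ q * Dw l (pdb c (w n)) q) := by
        funext q; ring
      rw [e]
      have c1 := ((e1.Dw l).sub ((hμ.pdb c).mul ((hw n).Dw l)))
      have c2 := (hμ.pdb c).mul ((hw n).Dw l)
      have c3 := (e2.Dw l).sub (hμ.mul (((hw n).pdb c).Dw l))
      refine (nrm_add_le (c1.add c2).cont c3.cont).trans ?_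
      refine add_le_add ((nrm_add_le c1.cont c2.cont).trans ?_) (h2b n)
      exact add_le_add (h1b n) (nrm_mul_le ((hw n).Dw l).cont hC)

lemma Dw_summable {U : L2T2 ≃ₗᵢ[ℂ] L2T2} (hU : SmoothCompat U)
    {δ : ℝ} (hδ0 : 0 < δ) (hδ1 : δ < 1)
    {ν : T2 → ℂ} (hν : SmoothT2 ν) (hνb : ∀ q : T2, ‖ν q‖ ≤ δ)
    (w : ℕ → T2 → ℂ) (hw : ∀ n, SmoothT2 (w n))
    (hr : ∀ n, URel U (fun q => ν q * w n q) (w (n + 1))) :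
    ∀ (k : ℕ) (l : List Bool), l.length = k → Summable fun n => nrm (Dw l (w n)) := by
  intro k
  induction k using Nat.strong_induction_on with
  | _ k ih =>
    intro l hl
    obtain ⟨b, b0, bs, hb⟩ := comm_summable l ν w hν hw
      (fun l' hl' => ih _ (by omega) l' rfl)
    refine summable_of_contract (fun n => nrm_nonneg _) hδ0 hδ1 b0 bs (fun n => ?_)
    have h1 := ((hr n).Dw hU l).nrm
    rw [h1]
    have e : Dw l (fun q => ν q * w n q) = fun q => ν q * Dw l (w n) q +
        (Dw l (fun q => ν q * w n q) q - ν q * Dw l (w n) q) := by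
      funext q; ring
    rw [e]
    have c1 := hν.mul ((hw n).Dw l)
    refine (nrm_add_le c1.cont (((hν.mul (hw n)).Dw l).sub c1).cont).trans ?_
    exact add_le_add (nrm_mul_le ((hw n).Dw l).cont hνb) (hb n)

lemma sob_one {h h' : AddCircle (2 * Real.pi) → ℂ} (hc : Continuous h) (hc' : Continuous h')
    (hd : ∀ x : ℝ, HasDerivAt (fun x : ℝ => h (x : AddCircle (2 * Real.pi)))
      (h' (x : AddCircle (2 * Real.pi))) x) (q : AddCircle (2 * Real.pi)) :
    (2 * Real.pi) * ‖h q‖ ≤ (∫ s, ‖h s‖) + (2 * Real.pi) * ∫ s, ‖h' s‖ := by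
  obtain ⟨x, rfl⟩ := QuotientAddGroup.mk_surjective q
  have hT : (0:ℝ) < 2 * Real.pi := by positivity
  have hcoe : Continuous (fun x : ℝ => (x : AddCircle (2 * Real.pi))) :=
    AddCircle.continuous_mk' _
  have i1 : Continuous (fun x : ℝ => h (x : AddCircle (2 * Real.pi))) := hc.comp hcoe
  have i2 : Continuous (fun x : ℝ => h' (x : AddCircle (2 * Real.pi))) := hc'.comp hcoe
  rw [← AddCircle.intervalIntegral_preimage (2 * Real.pi) x (fun s => ‖h s‖),
    ← AddCircle.intervalIntegral_preimage (2 * Real.pi) x (fun s => ‖h' s‖)]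
  set J := ∫ a in x..(x + 2 * Real.pi), ‖h' (a : AddCircle (2 * Real.pi))‖ with hJ
  have key : ∀ y ∈ Set.Icc x (x + 2 * Real.pi),
      ‖h (x : AddCircle (2 * Real.pi))‖ ≤ ‖h (y : AddCircle (2 * Real.pi))‖ + J := by
    intro y hy
    have e := intervalIntegral.integral_eq_sub_of_hasDerivAt (a := x) (b := y)
      (fun t _ => hd t) (i2.intervalIntegrable _ _)
    have e1 : ‖∫ t in x..y, h' (t : AddCircle (2 * Real.pi))‖ ≤ J := by
      refine (intervalIntegral.norm_integral_le_integral_norm hy.1).trans ?_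
      refine intervalIntegral.integral_mono_interval le_rfl hy.1 hy.2 ?_
        (i2.norm.intervalIntegrable _ _)
      exact Filter.Eventually.of_forall (fun _ => norm_nonneg _)
    rw [e] at e1
    have := norm_sub_norm_le (h (x : AddCircle (2 * Real.pi))) (h (y : AddCircle (2 * Real.pi)))
    rw [norm_sub_rev] at this
    linarith
  have m := intervalIntegral.integral_mono_on (a := x) (b := x + 2 * Real.pi) (by linarith)
    (μ := volume) (f := fun _ => ‖h (x : AddCircle (2 * Real.pi))‖)
    (g := fun y => ‖h (y : AddCircle (2 * Real.pi))‖ + J)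
    (by simp) ((i1.norm.add continuous_const).intervalIntegrable _ _) key
  rw [intervalIntegral.integral_add (i1.norm.intervalIntegrable _ _) (by simp)] at m
  simpa using m

lemma hasDeriv_one {g : T2 → ℂ} (hg : SmoothT2 g) (t : AddCircle (2 * Real.pi)) (x : ℝ) :
    HasDerivAt (fun x : ℝ => g ((x : AddCircle (2 * Real.pi)), t))
      (pdb true g ((x : AddCircle (2 * Real.pi)), t)) x := by
  obtain ⟨b, rfl⟩ := QuotientAddGroup.mk_surjective t
  have h1 := (hg.diff (x, b)).hasFDerivAt
  have h2 : HasDerivAt (fun x : ℝ => (x, b)) ((1 : ℝ), (0 : ℝ)) x :=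
    (hasDerivAt_id x).prodMk (hasDerivAt_const x b)
  have h3 := h1.comp_hasDerivAt x h2
  have h4 := pdb_proj true g (x, b)
  simp only [eb, if_true] at h4
  rw [← h4] at h3
  exact h3

lemma hasDeriv_two {g : T2 → ℂ} (hg : SmoothT2 g) (t : AddCircle (2 * Real.pi)) (x : ℝ) :
    HasDerivAt (fun x : ℝ => g (t, (x : AddCircle (2 * Real.pi))))
      (pdb false g (t, (x : AddCircle (2 * Real.pi)))) x := by
  obtain ⟨b, rfl⟩ := QuotientAddGroup.mk_surjective t
  have h1 := (hg.diff (b, x)).hasFDerivAt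
  have h2 : HasDerivAt (fun x : ℝ => (b, x)) ((0 : ℝ), (1 : ℝ)) x :=
    (hasDerivAt_const x b).prodMk (hasDerivAt_id x)
  have h3 := h1.comp_hasDerivAt x h2
  have h4 := pdb_proj false g (b, x)
  simp only [eb] at h4
  simp only [Bool.false_eq_true, if_false] at h4
  rw [← h4] at h3
  exact h3

lemma integrable_of_cont {X : Type*} [TopologicalSpace X] [CompactSpace X] [MeasurableSpace X]
    [OpensMeasurableSpace X] (μ : Measure X) [IsFiniteMeasure μ] {g : X → ℝ}
    (hg : Continuous g) : Integrable g μ :=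
  hg.integrable_of_hasCompactSupport (HasCompactSupport.of_compactSpace g)

lemma L1_le (g : T2 → ℂ) (hg : Continuous g) :
    ∫ q, ‖g q‖ ≤ nrm g * ((volume : Measure T2) Set.univ ^ ((1:ℝ) / 2)).toReal := by
  have h1 := memLp_of_cont hg 1
  have h2 := memLp_of_cont hg 2
  have h := eLpNorm_le_eLpNorm_mul_rpow_measure_univ (p := 1) (q := 2) (by norm_num) h1.1
  have e : ((1:ℝ) / (1 : ENNReal).toReal - 1 / (2 : ENNReal).toReal) = 1 / 2 := by norm_num
  rw [e] at h
  have h3 := ENNReal.toReal_mono (ENNReal.mul_ne_top h2.2.ne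
    (ENNReal.rpow_ne_top_of_nonneg (by norm_num) (measure_ne_top _ _))) h
  rw [ENNReal.toReal_mul] at h3
  refine le_trans (le_of_eq ?_) h3
  rw [eLpNorm_one_eq_lintegral_enorm, integral_norm_eq_lintegral_enorm h1.1]

lemma half_sob {g : T2 → ℂ} (hg : SmoothT2 g) (y : AddCircle (2 * Real.pi)) :
    (2 * Real.pi) * ∫ s, ‖g (s, y)‖ ≤ (∫ q, ‖g q‖) + (2 * Real.pi) * ∫ q, ‖pdb false g q‖ := by
  have c1 := hg.cont
  have c2 := (hg.pdb false).cont
  have hT : (0:ℝ) < 2 * Real.pi := by positivity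
  have I1 : Integrable (fun q : T2 => ‖g q‖) (volume : Measure T2) := integrable_of_cont _ c1.norm
  have I2 : Integrable (fun q : T2 => ‖pdb false g q‖) (volume : Measure T2) :=
    integrable_of_cont _ c2.norm
  have e1 : (∫ q, ‖g q‖) = ∫ s, ∫ t, ‖g (s, t)‖ := integral_prod _ I1
  have e2 : (∫ q, ‖pdb false g q‖) = ∫ s, ∫ t, ‖pdb false g (s, t)‖ := integral_prod _ I2
  rw [e1, e2, ← integral_const_mul, ← integral_const_mul,
    ← integral_add I1.integral_prod_left (I2.integral_prod_left.const_mul _)]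
  refine integral_mono ?_ (I1.integral_prod_left.add (I2.integral_prod_left.const_mul _)) ?_
  · exact integrable_of_cont _ (continuous_const.mul (c1.comp (by fun_prop)).norm)
  · intro s
    exact sob_one (h := fun t => g (s, t)) (h' := fun t => pdb false g (s, t))
      (c1.comp (by fun_prop)) (c2.comp (by fun_prop)) (hasDeriv_two hg s) y

lemma sob_arith {T X P Q A B C D : ℝ} (hT : 1 ≤ T) (a1 : T * X ≤ P + T * Q)
    (a2 : T * P ≤ A + T * B) (a3 : T * Q ≤ C + T * D) (n1 : 0 ≤ A) (n2 : 0 ≤ B) (n3 : 0 ≤ C) :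
    X ≤ A + B + C + D := by
  have hTT : T ≤ T * T := by nlinarith
  have f1 : T * T * X ≤ (A + T * B) + T * (C + T * D) := by
    have := mul_le_mul_of_nonneg_left a1 (by linarith : 0 ≤ T)
    have := mul_le_mul_of_nonneg_left a3 (by linarith : 0 ≤ T)
    nlinarith
  have f2 : T * T * X ≤ T * T * (A + B + C + D) := by
    have : A ≤ T * T * A := le_mul_of_one_le_left n1 (by linarith)
    have := mul_le_mul_of_nonneg_right hTT n2
    have := mul_le_mul_of_nonneg_right hTT n3
    nlinarith
  exact le_of_mul_le_mul_left f2 (by nlinarith)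

lemma sobolev : ∃ C : ℝ, 0 ≤ C ∧ ∀ g : T2 → ℂ, SmoothT2 g → ∀ q, ‖g q‖ ≤
    C * (nrm (Dw [] g) + nrm (Dw [false] g) + nrm (Dw [true] g) + nrm (Dw [true, false] g)) := by
  set K := ((volume : Measure T2) Set.univ ^ ((1:ℝ) / 2)).toReal with hK
  have hK0 : 0 ≤ K := ENNReal.toReal_nonneg
  have hT : (1:ℝ) ≤ 2 * Real.pi := by linarith [Real.pi_gt_three]
  refine ⟨K, hK0, fun g hg q => ?_⟩
  obtain ⟨x, y⟩ := q
  have c1 := hg.cont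
  have c2 := (hg.pdb true).cont
  have a1 := sob_one (h := fun t => g (t, y)) (h' := fun t => pdb true g (t, y))
      (c1.comp (by fun_prop)) (c2.comp (by fun_prop)) (hasDeriv_one hg y) x
  have a2 := half_sob hg y
  have a3 := half_sob (hg.pdb true) y
  have b1 := L1_le _ hg.cont
  have b2 := L1_le _ (hg.pdb false).cont
  have b3 := L1_le _ (hg.pdb true).cont
  have b4 := L1_le _ ((hg.pdb true).pdb false).cont
  simp only [Dw]
  rw [← hK] at b1 b2 b3 b4
  have n1 : 0 ≤ ∫ q, ‖g q‖ := integral_nonneg fun _ => norm_nonneg _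
  have n2 : 0 ≤ ∫ q, ‖pdb false g q‖ := integral_nonneg fun _ => norm_nonneg _
  have n3 : 0 ≤ ∫ q, ‖pdb true g q‖ := integral_nonneg fun _ => norm_nonneg _
  have f := sob_arith hT a1 a2 a3 n1 n2 n3
  linarith

lemma contDiff_series (n : ℕ) : ∀ (w : ℕ → T2 → ℂ), (∀ n, SmoothT2 (w n)) →
    (∀ l : List Bool, ∃ b : ℕ → ℝ, Summable b ∧ ∀ n q, ‖Dw l (w n) q‖ ≤ b n) →
    ContDiff ℝ n (fun p => ∑' k, w k (projT2 p)) := by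
  induction n with
  | zero =>
    intro w hw hb
    obtain ⟨b, bs, hb⟩ := hb []
    rw [Nat.cast_zero, contDiff_zero]
    exact continuous_tsum (fun k => ContDiff.continuous (hw k)) bs (fun k p => hb k _)
  | succ n ih =>
    intro w hw hb
    have hbb : ∀ c : Bool, ContDiff ℝ n (fun p => ∑' k, pdb c (w k) (projT2 p)) :=
      fun c => ih (fun k => pdb c (w k)) (fun k => (hw k).pdb c) (fun l => hb (c :: l))
    let A : ℝ × ℝ →L[ℝ] ℂ := Complex.ofRealCLM.comp (ContinuousLinearMap.fst ℝ ℝ ℝ)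
    let B : ℝ × ℝ →L[ℝ] ℂ := Complex.ofRealCLM.comp (ContinuousLinearMap.snd ℝ ℝ ℝ)
    obtain ⟨b0, b0s, hb0⟩ := hb []
    obtain ⟨b1, b1s, hb1⟩ := hb [true]
    obtain ⟨b2, b2s, hb2⟩ := hb [false]
    simp only [Dw] at hb0 hb1 hb2
    have s1 : ∀ p, Summable fun k => pdb true (w k) (projT2 p) := fun p =>
      Summable.of_norm_bounded b1s (fun k => hb1 k _)
    have s2 : ∀ p, Summable fun k => pdb false (w k) (projT2 p) := fun p =>
      Summable.of_norm_bounded b2s (fun k => hb2 k _)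
    push_cast
    rw [contDiff_succ_iff_hasFDerivAt]
    refine ⟨fun p => (∑' k, pdb true (w k) (projT2 p)) • A + (∑' k, pdb false (w k) (projT2 p)) • B,
      ((hbb true).smul contDiff_const).add ((hbb false).smul contDiff_const), fun p => ?_⟩
    have := hasFDerivAt_tsum (𝕜 := ℝ) (f := fun k p => w k (projT2 p))
      (f' := fun k p => pdb true (w k) (projT2 p) • A + pdb false (w k) (projT2 p) • B)
      (u := fun k => b1 k * ‖A‖ + b2 k * ‖B‖) (x₀ := 0)
      ((b1s.mul_right _).add (b2s.mul_right _)) ?_ ?_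
      (Summable.of_norm_bounded b0s (fun k => hb0 k _)) p
    · convert this using 1
      rw [Summable.tsum_add ((s1 p).smul_const A) ((s2 p).smul_const B),
        (s1 p).tsum_smul_const, (s2 p).tsum_smul_const]
    · intro k p
      have h := ((hw k).diff p).hasFDerivAt
      have e : pdb true (w k) (projT2 p) • A + pdb false (w k) (projT2 p) • B =
          fderiv ℝ (w k ∘ projT2) p := by
        refine ContinuousLinearMap.ext fun v => ?_
        have hv : v = v.1 • eb true + v.2 • eb false := by
          ext <;> simp [eb]
        rw [pdb_proj, pdb_proj]
        conv_rhs => rw [hv, map_add, map_smul, map_smul]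
        simp [A, B, mul_comm]
      exact e ▸ h
    · intro k p
      refine (norm_add_le _ _).trans ?_
      rw [norm_smul, norm_smul]
      gcongr
      · exact hb1 k _
      · exact hb2 k _

lemma smooth_series (w : ℕ → T2 → ℂ) (hw : ∀ n, SmoothT2 (w n))
    (hb : ∀ l : List Bool, ∃ b : ℕ → ℝ, Summable b ∧ ∀ n q, ‖Dw l (w n) q‖ ≤ b n) :
    SmoothT2 (fun q => ∑' k, w k q) :=
  contDiff_infty.2 (fun n => contDiff_series n w hw hb)

lemma Dw_append (l m : List Bool) : ∀ g, Dw m (Dw l g) = Dw (l ++ m) g := by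
  induction l with
  | nil => intro g; rfl
  | cons b l ih => intro g; exact ih _

lemma unif_bound {w : ℕ → T2 → ℂ} (hw : ∀ n, SmoothT2 (w n))
    (hs : ∀ l : List Bool, Summable fun n => nrm (Dw l (w n))) (l : List Bool) :
    ∃ b : ℕ → ℝ, Summable b ∧ ∀ n q, ‖Dw l (w n) q‖ ≤ b n := by
  obtain ⟨C, _, hC⟩ := sobolev
  refine ⟨_, ?_, fun n q => hC (Dw l (w n)) ((hw n).Dw l) q⟩
  simp only [Dw_append]
  exact ((((hs _).add (hs _)).add (hs _)).add (hs _)).mul_left C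

lemma exists_sol {U : L2T2 ≃ₗᵢ[ℂ] L2T2} (hU : SmoothCompat U)
    {δ : ℝ} (hδ0 : 0 < δ) (hδ1 : δ < 1)
    {ν : T2 → ℂ} (hν : SmoothT2 ν) (hνb : ∀ q : T2, ‖ν q‖ ≤ δ)
    {f : T2 → ℂ} (hf : SmoothT2 f) :
    ∃ s : T2 → ℂ, SmoothT2 s ∧ URel U (fun q => ν q * s q) (fun q => s q - f q) := by
  have hV : ∀ g : {g : T2 → ℂ // SmoothT2 g}, ∃ h : {g : T2 → ℂ // SmoothT2 g},
      URel U (fun q => ν q * g.1 q) h.1 := by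
    intro g
    obtain ⟨ψ, h1, h2, _⟩ := hU _ (hν.mul g.2)
    exact ⟨⟨ψ, h1⟩, hν.mul g.2, h1, h2⟩
  choose step hstep using hV
  let W : ℕ → {g : T2 → ℂ // SmoothT2 g} := fun n => step^[n] ⟨f, hf⟩
  let w : ℕ → T2 → ℂ := fun n => (W n).1
  have hw : ∀ n, SmoothT2 (w n) := fun n => (W n).2
  have hr : ∀ n, URel U (fun q => ν q * w n q) (w (n + 1)) := by
    intro n
    have : W (n + 1) = step (W n) := Function.iterate_succ_apply' _ _ _
    simp only [w, this]
    exact hstep (W n)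
  have hw0 : w 0 = f := rfl
  clear_value w
  have hs : ∀ l : List Bool, Summable fun n => nrm (Dw l (w n)) := fun l =>
    Dw_summable hU hδ0 hδ1 hν hνb w hw hr _ l rfl
  have hb := unif_bound hw hs
  have hsm := smooth_series w hw hb
  refine ⟨fun q => ∑' k, w k q, hsm, hν.mul hsm, hsm.sub hf, ?_⟩
  obtain ⟨b, bs, hb0⟩ := hb []
  simp only [Dw] at hb0
  let wc : ℕ → C(T2, ℂ) := fun n => ⟨w n, (hw n).cont⟩
  let nc : C(T2, ℂ) := ⟨ν, hν.cont⟩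
  have hsum : Summable wc := by
    refine Summable.of_norm_bounded bs (fun n => ?_)
    rw [ContinuousMap.norm_le _ ((norm_nonneg _).trans (hb0 n 0))]
    exact hb0 n
  let s : C(T2, ℂ) := ∑' n, wc n
  have hs1 : HasSum wc s := hsum.hasSum
  have hsq : ∀ q, s q = ∑' k, w k q := fun q => (ContinuousMap.tsum_apply hsum q).symm
  let L : C(T2, ℂ) →L[ℂ] L2T2 := ContinuousMap.toLp 2 (volume : Measure T2) ℂ
  have hL : ∀ g : C(T2, ℂ), ⇑(L g) =ᵐ[volume] g := fun g =>
    ContinuousMap.coeFn_toLp (𝕜 := ℂ) (volume : Measure T2) g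
  have h1 : HasSum (fun n => L (wc n)) (L s) := L.hasSum hs1
  have h2 : HasSum (fun n => U (L (nc * wc n))) (U (L (nc * s))) :=
    U.toContinuousLinearEquiv.toContinuousLinearMap.hasSum (L.hasSum (hs1.mul_left nc))
  have h3 : ∀ n, U (L (nc * wc n)) = L (wc (n + 1)) := by
    intro n
    refine Lp.ext ?_
    exact ((hr n).2.2 _ (hL (nc * wc n))).trans (hL (wc (n + 1))).symm
  simp only [h3] at h2
  have h4 : HasSum (fun n => L (wc (n + 1))) (L s - L (wc 0)) := by
    have := (hasSum_nat_add_iff' (f := fun n => L (wc n)) 1).2 h1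
    rwa [Finset.sum_range_one] at this
  have h5 : U (L (nc * s)) = L s - L (wc 0) := h2.unique h4
  intro g hg
  have e1 : g = L (nc * s) := by
    refine Lp.ext (hg.trans ((hL (nc * s)).trans (Filter.Eventually.of_forall fun q => ?_)).symm)
    simp [nc, hsq]
  rw [e1, h5]
  filter_upwards [Lp.coeFn_sub (L s) (L (wc 0)), hL s, hL (wc 0)] with q q1 q2 q3
  rw [q1, Pi.sub_apply, q2, q3, hsq]
  simp [wc, hw0]

lemma final_arith {δ a0 a1 a2 f0 f1 f2 M1 M2 : ℝ} (hδ0 : 0 < δ) (hδ1 : δ < 1)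
    (ha0 : 0 ≤ a0) (ha1 : 0 ≤ a1) (ha2 : 0 ≤ a2)
    (hM1 : 0 ≤ M1) (hM2 : 0 ≤ M2) (h0 : a0 ≤ f0 + δ * a0)
    (h1 : a1 ≤ f1 + (M1 * a0 + δ * a1)) (h2 : a2 ≤ f2 + (M2 * a0 + δ * a2)) :
    Real.sqrt (a0 ^ 2 + a1 ^ 2 + a2 ^ 2) ≤ 4 / (1 - δ) ^ 2 * (1 + M1 + M2) *
      Real.sqrt (f0 ^ 2 + f1 ^ 2 + f2 ^ 2) := by
  set S := Real.sqrt (f0 ^ 2 + f1 ^ 2 + f2 ^ 2) with hS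
  have hS0 : 0 ≤ S := Real.sqrt_nonneg _
  have l0 : f0 ≤ S := Real.le_sqrt_of_sq_le (by nlinarith)
  have l1 : f1 ≤ S := Real.le_sqrt_of_sq_le (by nlinarith)
  have l2 : f2 ≤ S := Real.le_sqrt_of_sq_le (by nlinarith)
  have hd : 0 < 1 - δ := by linarith
  have k0 : (1 - δ) * a0 ≤ S := by linarith
  have k1 : (1 - δ) * a1 ≤ S + M1 * a0 := by linarith
  have k2 : (1 - δ) * a2 ≤ S + M2 * a0 := by linarith
  have aux : ∀ M a : ℝ, 0 ≤ M → (1 - δ) * a ≤ S + M * a0 → (1 - δ) ^ 2 * a ≤ (1 + M) * S := by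
    intro M a hM h
    have e1 := mul_le_mul_of_nonneg_left h hd.le
    have e2 := mul_le_mul_of_nonneg_left k0 hM
    nlinarith
  have j0 := aux 0 a0 le_rfl (by linarith)
  have j1 := aux M1 a1 hM1 k1
  have j2 := aux M2 a2 hM2 k2
  have hR : Real.sqrt (a0 ^ 2 + a1 ^ 2 + a2 ^ 2) ≤ a0 + a1 + a2 := by
    refine Real.sqrt_le_iff.2 ⟨by positivity, ?_⟩
    nlinarith [mul_nonneg ha0 ha1, mul_nonneg ha0 ha2, mul_nonneg ha1 ha2]
  refine hR.trans ?_
  rw [div_mul_eq_mul_div, div_mul_eq_mul_div, le_div_iff₀ (by positivity)]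
  nlinarith [mul_nonneg hM1 hS0, mul_nonneg hM2 hS0]

lemma sob_eq {g : T2 → ℂ} (hg : SmoothT2 g) :
    sob1 g = Real.sqrt (nrm g ^ 2 + nrm (pdb true g) ^ 2 + nrm (pdb false g) ^ 2) := by
  rw [← l2sq_eq hg.cont, ← l2sq_eq (hg.pdb true).cont, ← l2sq_eq (hg.pdb false).cont]
  simp [sob1, pdb]

lemma sol_bound {U : L2T2 ≃ₗᵢ[ℂ] L2T2} (hU : SmoothCompat U)
    {δ : ℝ} (hδ0 : 0 < δ) (hδ1 : δ < 1)
    {ν : T2 → ℂ} (hν : SmoothT2 ν) (hνb : ∀ q : T2, ‖ν q‖ ≤ δ)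
    {f : T2 → ℂ} (hf : SmoothT2 f) {s : T2 → ℂ} (hs : SmoothT2 s)
    (h : URel U (fun q => ν q * s q) (fun q => s q - f q)) :
    sob1 s ≤ 4 / (1 - δ) ^ 2 *
          (1 + (⨆ q : T2, ‖pd1 ν q‖) + ⨆ q : T2, ‖pd2 ν q‖) * sob1 f := by
  rw [sob_eq hs, sob_eq hf]
  have key : ∀ c : Bool, nrm (pdb c s) ≤ nrm (pdb c f) +
      ((⨆ q, ‖pdb c ν q‖) * nrm s + δ * nrm (pdb c s)) := by
    intro c
    have h1 := (h.pdb hU c).nrm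
    rw [pdb_mul c hν hs] at h1
    have e : pdb c s = fun q => pdb c f q + pdb c (fun q => s q - f q) q := by
      rw [pdb_sub c hs hf]; funext q; ring
    have h2 := nrm_add_le (hf.pdb c).cont ((hs.sub hf).pdb c).cont
    rw [← e, h1] at h2
    refine h2.trans (add_le_add le_rfl ?_)
    refine (nrm_add_le ((hν.pdb c).mul hs).cont (hν.mul (hs.pdb c)).cont).trans ?_
    refine add_le_add (nrm_mul_le hs.cont fun q => ?_) (nrm_mul_le (hs.pdb c).cont hνb)
    exact le_ciSup (bdd_of_cont (hν.pdb c).cont) q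
  have key0 : nrm s ≤ nrm f + δ * nrm s := by
    have h1 := h.nrm
    have e : s = fun q => f q + (s q - f q) := by funext q; ring
    have h2 := nrm_add_le hf.cont (hs.sub hf).cont
    rw [← e, h1] at h2
    exact h2.trans (add_le_add le_rfl (nrm_mul_le hs.cont hνb))
  have k1 := key true
  have k2 := key false
  have p1 : pdb true ν = pd1 ν := rfl
  have p2 : pdb false ν = pd2 ν := rfl
  rw [p1] at k1
  rw [p2] at k2
  exact final_arith hδ0 hδ1 (nrm_nonneg _) (nrm_nonneg _) (nrm_nonneg _)
    (Real.iSup_nonneg fun _ => norm_nonneg _) (Real.iSup_nonneg fun _ => norm_nonneg _) key0 k1 k2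

/-- **Invertibility of `Id − U∘ν` with Sobolev `H¹` bound (Proposition 2.7).**
Let `U` be a unitary operator on `L²(𝕋²)` mapping `C^∞` functions to `C^∞`
functions and commuting with `∂/∂x₁`, `∂/∂x₂`. Let `0 < δ < 1` and let `ν` be
`C^∞` with `|ν| ≤ δ`. Then for every `C^∞` function `f` the equation
`u − U(ν·u) = f` has a unique solution `u ∈ L²(𝕋²)`; this solution is `C^∞` and,
with `C = 4/(1−δ)²`, satisfies
`‖u‖_{H¹} ≤ C (1 + max|∂ν/∂x₁| + max|∂ν/∂x₂|) ‖f‖_{H¹}`. -/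
theorem inverse_operator_bound
    (U : L2T2 ≃ₗᵢ[ℂ] L2T2) (hU : SmoothCompat U)
    (δ : ℝ) (hδ0 : 0 < δ) (hδ1 : δ < 1)
    (ν : T2 → ℂ) (hν : SmoothT2 ν) (hνb : ∀ q : T2, ‖ν q‖ ≤ δ)
    (f : T2 → ℂ) (hf : SmoothT2 f) :
    (∃! u : L2T2, ∃ v : L2T2,
      ⇑v =ᵐ[volume] (fun q => ν q * u q) ∧ ⇑(u - U v) =ᵐ[volume] f) ∧
    ∀ u : L2T2,
      (∃ v : L2T2, ⇑v =ᵐ[volume] (fun q => ν q * u q) ∧ ⇑(u - U v) =ᵐ[volume] f) →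
      ∃ usmooth : T2 → ℂ, SmoothT2 usmooth ∧ ⇑u =ᵐ[volume] usmooth ∧
        sob1 usmooth ≤ 4 / (1 - δ) ^ 2 *
          (1 + (⨆ q : T2, ‖pd1 ν q‖) + ⨆ q : T2, ‖pd2 ν q‖) * sob1 f := by
  obtain ⟨s, hs, h⟩ := exists_sol hU hδ0 hδ1 hν hνb hf
  have huniq : ∀ u u' : L2T2,
      (∃ v : L2T2, ⇑v =ᵐ[volume] (fun q => ν q * u q) ∧ ⇑(u - U v) =ᵐ[volume] f) →
      (∃ v : L2T2, ⇑v =ᵐ[volume] (fun q => ν q * u' q) ∧ ⇑(u' - U v) =ᵐ[volume] f) →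
      u = u' := by
    rintro u u' ⟨v, hv, hf1⟩ ⟨v', hv', hf2⟩
    have e : u - U v = u' - U v' := Lp.ext (hf1.trans hf2.symm)
    have e1 : u - u' = U (v - v') := by
      rw [map_sub]
      rw [sub_eq_sub_iff_add_eq_add] at e ⊢
      rw [e]; abel
    have e2 : ‖v - v'‖ ≤ δ * ‖u - u'‖ := by
      refine Lp.norm_le_mul_norm_of_ae_le_mul ?_
      filter_upwards [hv, hv', Lp.coeFn_sub v v', Lp.coeFn_sub u u'] with q q1 q2 q3 q4
      rw [q3, q4, Pi.sub_apply, Pi.sub_apply, q1, q2, ← mul_sub, norm_mul]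
      exact mul_le_mul_of_nonneg_right (hνb q) (norm_nonneg _)
    have e3 : ‖u - u'‖ = ‖v - v'‖ := by rw [e1, U.norm_map]
    have e4 : ‖u - u'‖ = 0 := by nlinarith [norm_nonneg (u - u')]
    exact sub_eq_zero.1 (norm_eq_zero.1 e4)
  obtain ⟨G, hG⟩ := exists_class hs.cont
  obtain ⟨N, hN⟩ := exists_class (hν.mul hs).cont
  have hGsol : ∃ v : L2T2, ⇑v =ᵐ[volume] (fun q => ν q * G q) ∧ ⇑(G - U v) =ᵐ[volume] f := by
    refine ⟨N, ?_, ?_⟩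
    · filter_upwards [hG, hN] with q q1 q2
      rw [q1, q2]
    · filter_upwards [hG, h.2.2 N hN, Lp.coeFn_sub G (U N)] with q q1 q2 q3
      rw [q3, Pi.sub_apply, q1, q2]
      ring
  refine ⟨⟨G, hGsol, fun u hu => huniq u G hu hGsol⟩, fun u hu => ?_⟩
  have : u = G := huniq u G hu hGsol
  subst this
  exact ⟨s, hs, hG, sol_bound hU hδ0 hδ1 hν hνb hf hs h⟩
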